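/- There is no 5×5 non-homogeneous integral Fourier matrix; that is, there is no 5×5 matrix s with rational integer entries such that s_{i0} = 1 for all i, det(s) ≠ 0, √(d_j)·s_{ij} = √(d_i)·s_{ji} for all i, j (where d_i := Σ_j s_{ij}²), N_{ijk} := Σ_l s_{li}·s_{lj}·s_{lk}/d_l is a rational integer for all i, j, k, and the degrees s_{01}², s_{02}², s_{03}², s_{04}² are not all equal. -/

import Mathlib

open Matrix BigOperators

lemma aux_final (a : Fin 5 → ℤ) (c : ℤ) (hc : 0 < c) (ha : ∀ i, 0 < a i)
    (hd : ∀ i, a i ∣ c) (hs : ∑ i, a i ^ 2 = c ^ 2) : False := by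
  have pos : ∀ i, 0 < a i ^ 2 := fun i => pow_pos (ha i) 2
  have hcc : 0 < c ^ 2 := pow_pos hc 2
  rw [Fin.sum_univ_five] at hs
  have key : ∀ i, a i ^ 2 = c ^ 2 ∨ 4 * a i ^ 2 = c ^ 2 ∨ 9 * a i ^ 2 ≤ c ^ 2 := by
    intro i
    obtain ⟨b, hb⟩ := hd i
    have hb0 : 0 < b := by
      by_contra h
      push Not at h
      nlinarith [ha i]
    have : b = 1 ∨ b = 2 ∨ 3 ≤ b := by omega
    rcases this with h | h | h
    · left; rw [hb, h]; ring
    · right; left; rw [hb, h]; ring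
    · right; right
      rw [hb, mul_pow]
      have : 9 ≤ b ^ 2 := by nlinarith
      nlinarith [pos i]
  have p0 := pos 0
  have p1 := pos 1
  have p2 := pos 2
  have p3 := pos 3
  have p4 := pos 4
  rcases key 0 with h0 | h0 | h0 <;> rcases key 1 with h1 | h1 | h1 <;>
  rcases key 2 with h2 | h2 | h2 <;> rcases key 3 with h3 | h3 | h3 <;>
  rcases key 4 with h4 | h4 | h4 <;> linarith

/-- there is no `5 × 5` non-homogeneous integral Fourier matrix. -/
theorem stmt18 :
    ¬ ∃ s : Matrix (Fin 5) (Fin 5) ℤ,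
      (∀ i, s i 0 = 1) ∧
      s.det ≠ 0 ∧
      (∀ i j : Fin 5,
        Real.sqrt (∑ l, ((s j l : ℝ)) ^ 2) * (s i j : ℝ) =
        Real.sqrt (∑ l, ((s i l : ℝ)) ^ 2) * (s j i : ℝ)) ∧
      (∀ i j k : Fin 5, ∃ z : ℤ,
        (∑ l, ((s l i : ℚ) * (s l j : ℚ) * (s l k : ℚ)) / (∑ m, ((s l m : ℚ)) ^ 2))
          = (z : ℚ)) ∧
      ¬ (s 0 1 ^ 2 = s 0 2 ^ 2 ∧ s 0 2 ^ 2 = s 0 3 ^ 2 ∧ s 0 3 ^ 2 = s 0 4 ^ 2) := by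
  rintro ⟨s, h1, hdet, hsym, hN, -⟩
  set D : Fin 5 → ℤ := fun i => ∑ l, s i l ^ 2 with hD
  have hDpos : ∀ i, 0 < D i := by
    intro i
    have : s i 0 ^ 2 ≤ D i :=
      Finset.single_le_sum (f := fun l => s i l ^ 2) (fun l _ => sq_nonneg _) (Finset.mem_univ 0)
    rw [h1] at this
    linarith
  have hDR : ∀ i, (∑ l, ((s i l : ℝ)) ^ 2) = (D i : ℝ) := by
    intro i; simp [hD]
  have hDQ : ∀ i, (∑ l, ((s i l : ℚ)) ^ 2) = (D i : ℚ) := by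
    intro i; simp [hD]
  simp only [hDR] at hsym
  simp only [hDQ] at hN
  have hDposR : ∀ i, (0 : ℝ) < Real.sqrt (D i : ℝ) := fun i =>
    Real.sqrt_pos.2 (by exact_mod_cast hDpos i)
  have h0 : ∀ i, Real.sqrt (D 0 : ℝ) = Real.sqrt (D i : ℝ) * (s 0 i : ℝ) := by
    intro i
    have := hsym i 0
    rw [h1] at this
    simpa using this
  set a : Fin 5 → ℤ := fun i => s 0 i with hadef
  have ha : ∀ i, 0 < a i := by
    intro i
    have h := h0 i
    have : (0 : ℝ) < (s 0 i : ℝ) := by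
      by_contra hn
      push Not at hn
      nlinarith [hDposR i, hDposR 0]
    exact_mod_cast this
  have hn : ∀ i, D 0 = a i ^ 2 * D i := by
    intro i
    have h := congrArg (fun x => x ^ 2) (h0 i)
    simp only [mul_pow] at h
    rw [Real.sq_sqrt (by exact_mod_cast (hDpos 0).le),
      Real.sq_sqrt (by exact_mod_cast (hDpos i).le)] at h
    have : (D 0 : ℝ) = (a i : ℝ) ^ 2 * D i := by rw [h]; ring
    exact_mod_cast this
  have hX : ∀ i j, a i * s i j = a j * s j i := by
    intro i j
    have e := hsym i j
    have ei := h0 i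
    have ej := h0 j
    have : Real.sqrt (D 0 : ℝ) * ((a i : ℝ) * s i j) = Real.sqrt (D 0 : ℝ) * ((a j : ℝ) * s j i) := by
      calc _ = (Real.sqrt (D j : ℝ) * (s 0 j : ℝ)) * ((a i : ℝ) * s i j) := by rw [ej]
        _ = (Real.sqrt (D j : ℝ) * s i j) * (s 0 j : ℝ) * (s 0 i : ℝ) := by simp only [hadef]; ring
        _ = (Real.sqrt (D i : ℝ) * (s 0 i : ℝ)) * ((s 0 j : ℝ) * s j i) := by rw [e]; ring
        _ = _ := by rw [← ei]
    have := mul_left_cancel₀ (hDposR 0).ne' this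
    exact_mod_cast this
  set n := D 0 with hndef
  have hnpos : 0 < n := hDpos 0
  let X : Matrix (Fin 5) (Fin 5) ℤ := Matrix.diagonal a * s
  have hXe : ∀ i j, X i j = a i * s i j := by
    intro i j; simp [X, Matrix.diagonal_mul]
  have hXs : ∀ i j, X i j = X j i := by
    intro i j; rw [hXe, hXe, hX]
  have hXdet : X.det ≠ 0 := by
    simp only [X, Matrix.det_mul, Matrix.det_diagonal]
    exact mul_ne_zero (Finset.prod_ne_zero_iff.2 fun i _ => (ha i).ne') hdet
  have hdiag : ∀ i, ∑ l, X l i ^ 2 = n := by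
    intro i
    rw [hn i, hD, Finset.mul_sum]
    refine Finset.sum_congr rfl fun l _ => ?_
    rw [hXs, hXe]; ring
  have hZ : ∀ i j, ∃ z : ℤ, ∑ l, X l i * X l j = n * z := by
    intro i j
    obtain ⟨z, hz⟩ := hN i j 0
    refine ⟨z, ?_⟩
    have : (∑ l, (X l i : ℚ) * X l j) = n * z := by
      rw [← hz, Finset.mul_sum]
      refine Finset.sum_congr rfl fun l _ => ?_
      have hl : (n : ℚ) = (a l : ℚ) ^ 2 * D l := by exact_mod_cast hn l
      have hl0 : (D l : ℚ) ≠ 0 := by exact_mod_cast (hDpos l).ne'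
      rw [hXe, hXe, h1, hl]
      push_cast
      field_simp
    exact_mod_cast this
  have hoff : ∀ i j, i ≠ j → ∑ l, X l i * X l j = 0 := by
    intro i j hij
    obtain ⟨z, hz⟩ := hZ i j
    have hsq : ∑ l, (X l i - z * X l j) ^ 2 = n * (1 - z ^ 2) := by
      have : ∑ l, (X l i - z * X l j) ^ 2
          = ∑ l, X l i ^ 2 - 2 * z * ∑ l, X l i * X l j + z ^ 2 * ∑ l, X l j ^ 2 := by
        rw [Finset.mul_sum, Finset.mul_sum, ← Finset.sum_sub_distrib, ← Finset.sum_add_distrib]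
        exact Finset.sum_congr rfl fun l _ => by ring
      rw [this, hdiag, hdiag, hz]; ring
    have hpos : 0 < ∑ l, (X l i - z * X l j) ^ 2 := by
      refine lt_of_le_of_ne (Finset.sum_nonneg fun l _ => sq_nonneg _) fun h => hXdet ?_
      have hz0 := (Finset.sum_eq_zero_iff_of_nonneg (fun l _ => sq_nonneg _)).1 h.symm
      refine Matrix.exists_mulVec_eq_zero_iff.1 ⟨Pi.single i 1 - z • Pi.single j 1, ?_, ?_⟩
      · intro h
        have := congrFun h i
        simp [hij] at this
      · ext l
        have := pow_eq_zero_iff (two_ne_zero) |>.1 (hz0 l (Finset.mem_univ l))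
        rw [Matrix.mulVec_sub, Matrix.mulVec_smul]
        simpa using this
    rw [hsq] at hpos
    have : 0 < 1 - z ^ 2 := pos_of_mul_pos_right hpos hnpos.le
    have : z ^ 2 = 0 := by have := sq_nonneg z; omega
    have : z = 0 := by simpa using this
    rw [hz, this, mul_zero]
  have hXX : Xᵀ * X = Matrix.diagonal fun _ => n := by
    ext i j
    rw [Matrix.mul_apply]
    simp only [Matrix.transpose_apply]
    by_cases hij : i = j
    · subst hij
      rw [Matrix.diagonal_apply_eq, ← hdiag i]
      exact Finset.sum_congr rfl fun l _ => by ring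
    · rw [Matrix.diagonal_apply_ne _ hij, hoff i j hij]
  have hdet2 : X.det ^ 2 = n ^ 5 := by
    have := congrArg Matrix.det hXX
    rw [Matrix.det_mul, Matrix.det_transpose, Matrix.det_diagonal] at this
    simp at this
    rw [sq, this]
  obtain ⟨q, hq⟩ : n ^ 2 ∣ X.det := by
    rw [← Int.pow_dvd_pow_iff two_ne_zero, hdet2]
    exact ⟨n, by ring⟩
  have hnq : n = q ^ 2 := by
    rw [hq] at hdet2
    have : n ^ 4 * n = n ^ 4 * q ^ 2 := by linear_combination -hdet2
    exact mul_left_cancel₀ (pow_pos hnpos 4).ne' this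
  refine aux_final a |q| ?_ ha ?_ ?_
  · rw [abs_pos]; rintro rfl; simp at hnq; omega
  · intro i
    rw [dvd_abs, ← Int.pow_dvd_pow_iff two_ne_zero, ← hnq]
    exact ⟨_, hn i⟩
  · rw [sq_abs, ← hnq]
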